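/- Let X be a countable OHI crowded space and let p ∈ X* be a remote point of X which is a weak P-point of X*. Then p is a lonely point of βX. -/

import Mathlib

def IsDiscreteSet {X : Type*} [TopologicalSpace X] (D : Set X) : Prop :=
  ∀ x ∈ D, ∃ U : Set X, IsOpen U ∧ U ∩ D = {x}

def IsLonely {X : Type*} [TopologicalSpace X] (p : X) : Prop :=
  (∀ D : Set X, D.Countable → IsDiscreteSet D → p ∉ closure (D \ {p})) ∧
  (∃ S : Set X, S.Countable ∧ (∀ x ∈ S, x ∈ closure (S \ {x})) ∧ p ∈ closure (S \ {p})) ∧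
  (∀ A B : Set X, A.Countable → B.Countable →
    p ∈ closure (A \ {p}) → p ∈ closure (B \ {p}) → p ∈ closure ((A ∩ B) \ {p}))

section

open Set Topology

theorem IsDiscreteSet.mono {X : Type*} [TopologicalSpace X] {D E : Set X}
    (hD : IsDiscreteSet D) (h : E ⊆ D) : IsDiscreteSet E := by
  intro x hx
  obtain ⟨U, hU, hUD⟩ := hD x (h hx)
  refine ⟨U, hU, Subset.antisymm (fun y hy => ?_) ?_⟩
  · exact hUD ▸ (⟨hy.1, h hy.2⟩ : y ∈ U ∩ D)
  · rintro y rfl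
    have : y ∈ U ∩ D := hUD ▸ mem_singleton y
    exact ⟨this.1, hx⟩

/-- A discrete subset of a crowded open-hereditarily irresolvable space is nowhere dense. -/
theorem IsDiscreteSet.interior_closure_eq_empty {X : Type*} [TopologicalSpace X]
    (hcrowded : ∀ x : X, ¬ IsOpen ({x} : Set X))
    (hOHI : ∀ U : Set X, IsOpen U → U.Nonempty →
      ¬ ∃ D₀ D₁ : Set X, D₀ ⊆ U ∧ D₁ ⊆ U ∧ Disjoint D₀ D₁ ∧ U ⊆ closure D₀ ∧ U ⊆ closure D₁)
    {N : Set X} (hN : IsDiscreteSet N) : interior (closure N) = ∅ := by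
  by_contra hne
  obtain ⟨y, hy⟩ := nonempty_iff_ne_empty.2 hne
  obtain ⟨x, hxU, hxN⟩ :=
    mem_closure_iff.1 (interior_subset hy) _ isOpen_interior hy
  obtain ⟨V, hV, hVN⟩ := hN x hxN
  have hxV : x ∈ V := (hVN ▸ mem_singleton x : x ∈ V ∩ N).1
  have hWo : IsOpen (interior (closure N) ∩ V) := isOpen_interior.inter hV
  set W := interior (closure N) ∩ V with hW
  have hxW : x ∈ W := ⟨hxU, hxV⟩
  refine hOHI W hWo ⟨x, hxW⟩ ⟨{x}, W \ {x}, by simpa using hxW, sdiff_subset,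
    disjoint_sdiff_right, fun z hz => ?_, fun z hz => ?_⟩
  · refine mem_closure_iff.2 fun O hO hzO => ?_
    obtain ⟨w, ⟨hwO, hwW⟩, hwN⟩ :=
      mem_closure_iff.1 (interior_subset hz.1) (O ∩ W) (hO.inter hWo) ⟨hzO, hz⟩
    have : w ∈ V ∩ N := ⟨hwW.2, hwN⟩
    exact ⟨w, hwO, hVN ▸ this⟩
  · by_cases hzx : z = x
    · subst hzx
      refine mem_closure_iff.2 fun O hO hzO => ?_
      by_contra hemp
      apply hcrowded z
      convert hO.inter hWo
      refine Subset.antisymm (by simpa using ⟨hzO, hz⟩) fun w hw => ?_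
      by_contra hwz
      exact hemp ⟨w, hw.1, hw.2, hwz⟩
    · exact subset_closure ⟨hz, hzx⟩

/-- Disjoint open subsets of `X` cannot both accumulate at a remote point of `X`. -/
theorem StoneCech.notMem_closure_image_of_disjoint_isOpen {X : Type*} [TopologicalSpace X]
    {p : StoneCech X}
    (hremote : ∀ N : Set X, interior (closure N) = ∅ → p ∉ closure (stoneCechUnit '' N))
    {U V : Set X} (hU : IsOpen U) (hUV : Disjoint U V)
    (hpU : p ∈ closure (stoneCechUnit '' U)) : p ∉ closure (stoneCechUnit '' V) := by
  classical
  intro hpV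
  have hfr : interior (closure (frontier U)) = ∅ := by
    rw [isClosed_frontier.closure_eq, ← frontier_compl]
    exact interior_frontier hU.isClosed_compl
  obtain ⟨f, hf0, hf1, hf⟩ := exists_continuous_zero_one_of_isClosed
    (isClosed_closure (s := (stoneCechUnit '' frontier U : Set (StoneCech X))))
    (isClosed_singleton (x := p)) (disjoint_singleton_right.2 (hremote _ hfr))
  let g : X → unitInterval := U.piecewise (fun x => ⟨f (stoneCechUnit x), hf _⟩) 0
  have hg : Continuous g := by
    refine Continuous.piecewise (fun x hx => Subtype.ext ?_) 
      ((f.continuous.comp continuous_stoneCechUnit).subtype_mk _) continuous_const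
    exact hf0 (subset_closure ⟨x, hx, rfl⟩)
  have hG := continuous_stoneCechExtend hg
  have h1 : ((stoneCechExtend hg p : unitInterval) : ℝ) = f p := by
    have : EqOn (fun q => ((stoneCechExtend hg q : unitInterval) : ℝ)) f (closure (stoneCechUnit '' U)) := by
      refine EqOn.closure ?_ (by fun_prop) (by fun_prop)
      rintro _ ⟨x, hx, rfl⟩
      simp [stoneCechExtend_stoneCechUnit, g, hx]
    exact this hpU
  have h0 : ((stoneCechExtend hg p : unitInterval) : ℝ) = 0 := by
    have : EqOn (fun q => ((stoneCechExtend hg q : unitInterval) : ℝ)) 0 (closure (stoneCechUnit '' V)) := by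
      refine EqOn.closure ?_ (by fun_prop) continuous_const
      rintro _ ⟨x, hx, rfl⟩
      simp [stoneCechExtend_stoneCechUnit, g, hUV.notMem_of_mem_right hx]
    exact this hpV
  rw [h0, hf1 rfl] at h1
  exact zero_ne_one h1

theorem StoneCech.mem_closure_inter_range {X : Type*} [TopologicalSpace X] {p : StoneCech X}
    (hwP : ∀ C : Set (StoneCech X), C ⊆ (range (stoneCechUnit : X → StoneCech X))ᶜ →
      C.Countable → p ∉ closure (C \ {p}))
    {A : Set (StoneCech X)} (hA : A.Countable) (hp : p ∈ closure (A \ {p})) :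
    p ∈ closure (A ∩ range (stoneCechUnit : X → StoneCech X)) := by
  have hsub : A \ {p} ⊆ (A ∩ range (stoneCechUnit : X → StoneCech X)) ∪
      ((A \ range (stoneCechUnit : X → StoneCech X)) \ {p}) := by
    rintro x ⟨hx, hxp⟩
    by_cases hr : x ∈ range (stoneCechUnit : X → StoneCech X)
    · exact Or.inl ⟨hx, hr⟩
    · exact Or.inr ⟨⟨hx, hr⟩, hxp⟩
  have h := closure_mono hsub hp
  rw [closure_union] at h
  exact h.resolve_right (hwP _ (fun x hx => hx.2) (hA.mono sdiff_subset))

theorem StoneCech.notMem_closure_of_isDiscreteSet {X : Type*} [TopologicalSpace X]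
    (hcrowded : ∀ x : X, ¬ IsOpen ({x} : Set X))
    (hOHI : ∀ U : Set X, IsOpen U → U.Nonempty →
      ¬ ∃ D₀ D₁ : Set X, D₀ ⊆ U ∧ D₁ ⊆ U ∧ Disjoint D₀ D₁ ∧ U ⊆ closure D₀ ∧ U ⊆ closure D₁)
    {p : StoneCech X}
    (hremote : ∀ N : Set X, interior (closure N) = ∅ → p ∉ closure (stoneCechUnit '' N))
    {D : Set (StoneCech X)} (hD : IsDiscreteSet D)
    (hDr : D ⊆ range (stoneCechUnit : X → StoneCech X)) : p ∉ closure D := by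
  obtain ⟨N, hND, hinj⟩ := SurjOn.exists_bijOn_subset (f := (stoneCechUnit : X → StoneCech X))
    (s := univ) (t := D) (fun y hy => by simpa using hDr hy)
  rw [← hinj.image_eq] at hD ⊢
  refine hremote N (IsDiscreteSet.interior_closure_eq_empty hcrowded hOHI fun x hx => ?_)
  obtain ⟨U, hU, hUD⟩ := hD _ (mem_image_of_mem _ hx)
  refine ⟨stoneCechUnit ⁻¹' U, hU.preimage continuous_stoneCechUnit,
    Subset.antisymm (fun y hy => ?_) ?_⟩
  · have : stoneCechUnit y ∈ U ∩ stoneCechUnit '' N := ⟨hy.1, mem_image_of_mem _ hy.2⟩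
    rw [hUD] at this
    exact hinj.injOn hy.2 hx this
  · rintro y rfl
    have : stoneCechUnit y ∈ U ∩ stoneCechUnit '' N := hUD ▸ mem_singleton _
    exact ⟨this.1, hx⟩

/-- If no discrete subset of `R` accumulates at `p ∈ closure R`, then `p` is in the closure of a
crowded subset of `R`. -/
theorem exists_crowded_subset_mem_closure {Y : Type*} [TopologicalSpace Y] {R : Set Y} {p : Y}
    (hp : p ∈ closure R) (hR : ∀ D ⊆ R, IsDiscreteSet D → p ∉ closure D) :
    ∃ S ⊆ R, (∀ x ∈ S, x ∈ closure (S \ {x})) ∧ p ∈ closure S := by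
  let I : Set Y := {y ∈ R | ∃ U : Set Y, IsOpen U ∧ U ∩ R = {y}}
  have hI : IsDiscreteSet I := by
    rintro y ⟨hy, U, hU, hUR⟩
    refine ⟨U, hU, Subset.antisymm (fun z hz => hUR ▸ ⟨hz.1, hz.2.1⟩) ?_⟩
    rintro z rfl
    have : z ∈ U ∩ R := hUR ▸ mem_singleton z
    exact ⟨this.1, hy, U, hU, hUR⟩
  have hpI : p ∉ closure I := hR I (fun y hy => hy.1) hI
  refine ⟨R \ closure I, sdiff_subset, ?_, ?_⟩
  · rintro x ⟨hxR, hxI⟩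
    refine mem_closure_iff.2 fun O hO hxO => ?_
    by_contra hemp
    refine hxI (subset_closure ⟨hxR, O ∩ (closure I)ᶜ,
      hO.inter isClosed_closure.isOpen_compl, Subset.antisymm (fun w hw => ?_) ?_⟩)
    · by_contra hwx
      exact hemp ⟨w, hw.1.1, ⟨hw.2, hw.1.2⟩, hwx⟩
    · rintro w rfl
      exact ⟨⟨hxO, hxI⟩, hxR⟩
  · have h : p ∈ closure (R \ closure I ∪ closure I) := closure_mono (by simp) hp
    rw [closure_union, closure_closure] at h
    exact h.resolve_right hpI

/-- A set accumulating at a remote point still does so after intersecting with the interior of its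
closure. -/
theorem StoneCech.mem_closure_image_interior_closure {X : Type*} [TopologicalSpace X]
    {p : StoneCech X}
    (hremote : ∀ N : Set X, interior (closure N) = ∅ → p ∉ closure (stoneCechUnit '' N))
    {A : Set X} (hp : p ∈ closure (stoneCechUnit '' A)) :
    p ∈ closure (stoneCechUnit '' interior (closure A)) := by
  have hsub : A ⊆ interior (closure A) ∪ frontier (closure A) := by
    rw [isClosed_closure.frontier_eq, union_sdiff_self]
    exact subset_closure.trans subset_union_right
  have h := closure_mono (image_mono hsub) hp
  rw [image_union, closure_union] at h
  refine h.resolve_right (hremote _ ?_)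
  rw [isClosed_frontier.closure_eq]
  exact interior_frontier isClosed_closure

theorem disjoint_interior_closure_of_irresolvable {X : Type*} [TopologicalSpace X]
    (hOHI : ∀ U : Set X, IsOpen U → U.Nonempty →
      ¬ ∃ D₀ D₁ : Set X, D₀ ⊆ U ∧ D₁ ⊆ U ∧ Disjoint D₀ D₁ ∧ U ⊆ closure D₀ ∧ U ⊆ closure D₁)
    {A B : Set X} (hAB : Disjoint A B) :
    Disjoint (interior (closure A)) (interior (closure B)) := by
  rw [disjoint_iff_inter_eq_empty]
  by_contra hne
  have hUo : IsOpen (interior (closure A) ∩ interior (closure B)) :=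
    isOpen_interior.inter isOpen_interior
  set U := interior (closure A) ∩ interior (closure B)
  refine hOHI U hUo (nonempty_iff_ne_empty.2 hne) ⟨U ∩ A, U ∩ B, inter_subset_left,
    inter_subset_left, hAB.mono inter_subset_right inter_subset_right,
    fun x hx => hUo.inter_closure ⟨hx, interior_subset hx.1⟩,
    fun x hx => hUo.inter_closure ⟨hx, interior_subset hx.2⟩⟩

end

/-- A remote point of a countable crowded OHI space X which is a weak P-point of X*
is a lonely point of βX. -/
theorem remote_weak_P_point_lonely {X : Type*} [TopologicalSpace X] [Countable X]
    (hcrowded : ∀ x : X, ¬ IsOpen ({x} : Set X))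
    (hOHI : ∀ U : Set X, IsOpen U → U.Nonempty →
      ¬ ∃ D₀ D₁ : Set X, D₀ ⊆ U ∧ D₁ ⊆ U ∧ Disjoint D₀ D₁ ∧ U ⊆ closure D₀ ∧ U ⊆ closure D₁)
    (p : StoneCech X)
    (hrem : p ∉ Set.range (stoneCechUnit : X → StoneCech X))
    (hremote : ∀ N : Set X, interior (closure N) = ∅ → p ∉ closure (stoneCechUnit '' N))
    (hwP : ∀ C : Set (StoneCech X), C ⊆ (Set.range (stoneCechUnit : X → StoneCech X))ᶜ →
      C.Countable → p ∉ closure (C \ {p})) :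
    IsLonely p := by
  refine ⟨fun D hDc hD hp => ?_, ?_, fun A B hA hB hpA hpB => ?_⟩
  · exact StoneCech.notMem_closure_of_isDiscreteSet hcrowded hOHI hremote
      (hD.mono Set.inter_subset_left) Set.inter_subset_right
      (StoneCech.mem_closure_inter_range hwP hDc hp)
  · obtain ⟨S, hSR, hS, hpS⟩ := exists_crowded_subset_mem_closure
      (denseRange_stoneCechUnit p) fun D hDR hD =>
        StoneCech.notMem_closure_of_isDiscreteSet hcrowded hOHI hremote hD hDR
    refine ⟨S, (Set.countable_range _).mono hSR, hS, ?_⟩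
    rwa [Set.sdiff_singleton_eq_self fun h => hrem (hSR h)]
  · refine mem_closure_iff.2 fun W hW hpW => ?_
    by_contra hemp
    have key : ∀ C : Set (StoneCech X), C.Countable → p ∈ closure (C \ {p}) →
        p ∈ closure (stoneCechUnit '' interior (closure (stoneCechUnit ⁻¹' (W ∩ C)))) := by
      intro C hC hpC
      refine StoneCech.mem_closure_image_interior_closure hremote ?_
      rw [Set.image_preimage_eq_inter_range, Set.inter_assoc]
      exact hW.inter_closure ⟨hpW, StoneCech.mem_closure_inter_range hwP hC hpC⟩
    have hdisj : Disjoint (stoneCechUnit ⁻¹' (W ∩ A)) (stoneCechUnit ⁻¹' (W ∩ B) : Set X) := by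
      refine Set.disjoint_left.2 fun x hxA hxB => hemp ⟨_, hxA.1, ⟨hxA.2, hxB.2⟩, ?_⟩
      exact fun h => hrem ⟨x, h⟩
    exact StoneCech.notMem_closure_image_of_disjoint_isOpen hremote isOpen_interior
      (disjoint_interior_closure_of_irresolvable hOHI hdisj) (key A hA hpA) (key B hB hpB)
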